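/- Let I = {i₁ < i₂ < ... < i_k} ⊆ {1,...,n−1}. The number of permutations π of {1,...,n+1} that are single (n+1)-cycles and whose descent set satisfies D(π) ⊆ I ∪ {n} equals the multinomial coefficient n! / (i₁!·(i₂−i₁)!···(i_k−i_{k−1})!·(n−i_k)!). -/

import Mathlib

def descSeq {n : ℕ} (f : Fin n → ℕ) : Finset ℕ :=
  (Finset.range (n - 1)).filter
    (fun i => ∃ h : i + 1 < n, f ⟨i + 1, h⟩ < f ⟨i, Nat.lt_of_succ_lt h⟩)

def descSet {n : ℕ} (σ : Equiv.Perm (Fin n)) : Finset ℕ :=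
  descSeq (fun i => (σ i : ℕ))

def IsCyclic' {n : ℕ} (π : Equiv.Perm (Fin n)) : Prop :=
  ∀ x y : Fin n, ∃ k : ℕ, (π ^ k) x = y

def compParts (n : ℕ) (I : Finset ℕ) : Multiset ℕ :=
  ↑(List.zipWith (· - ·) ((I.sort (· ≤ ·)).map (· + 1) ++ [n])
      (0 :: (I.sort (· ≤ ·)).map (· + 1)))

def fullCycleType {n : ℕ} (π : Equiv.Perm (Fin n)) : Multiset ℕ :=
  π.cycleType + Multiset.replicate (n - π.support.card) 1

def InT0 (n : ℕ) (τ : Fin n → ℕ) : Prop :=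
  ∃ (π : Equiv.Perm (Fin n)) (k : Fin n), IsCyclic' π ∧
    τ = Function.update (fun i => ((π i : ℕ) + 1)) k 0

def InU (n : ℕ) (τ : Fin n → ℕ) : Prop :=
  ∃ (π : Equiv.Perm (Fin n)) (k : Fin n), IsCyclic' π ∧
    τ = Function.update (fun i => ((π i : ℕ) + 1)) k (n + 1)

def extPerm {n : ℕ} (π : Equiv.Perm (Fin n)) : Equiv.Perm (Fin (n + 1)) :=
  (finSuccEquivLast (n := n)).symm.permCongr π.optionCongr

def extCycle {n : ℕ} (π : Equiv.Perm (Fin n)) (k : Fin n) : Equiv.Perm (Fin (n + 1)) :=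
  extPerm π * Equiv.swap (Fin.castSucc k) (Fin.last n)

section CyclicDescents

open Equiv
open scoped Fin.CommRing

/-- `e` lists `Fin (n + 1)` starting from the last element, and the successor map
`e i ↦ e (i + 1)` is increasing on the fibres of `b`. -/
def IsBlockListing {n : ℕ} (b : Fin (n + 1) → ℕ) (e : Perm (Fin (n + 1))) : Prop :=
  e 0 = Fin.last n ∧ ∀ i j, b (e i) = b (e j) → e i < e j → e (i + 1) < e (j + 1)

/-- The index of the block containing `x` when the positions in `J` are the block ends. -/
def blockIndex (J : Finset ℕ) (x : ℕ) : ℕ := (J.filter (· < x)).card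

lemma blockIndex_mono (J : Finset ℕ) : Monotone (blockIndex J) := fun _ _ h =>
  Finset.card_le_card (Finset.monotone_filter_right _ fun _ _ hi => lt_of_lt_of_le hi h)

lemma blockIndex_eq_iff (J : Finset ℕ) {x y : ℕ} (hxy : x ≤ y) :
    blockIndex J x = blockIndex J y ↔ ∀ i, x ≤ i → i < y → i ∉ J := by
  have hsub : J.filter (· < x) ⊆ J.filter (· < y) :=
    Finset.monotone_filter_right _ fun _ _ hi => lt_of_lt_of_le hi hxy
  constructor
  · intro h i hxi hiy hi
    have := Finset.eq_of_subset_of_card_le hsub h.ge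
    have h2 : i ∈ J.filter (· < x) := by rw [this]; simp [hi, hiy]
    simp at h2
    omega
  · intro h
    unfold blockIndex
    congr 1
    ext i
    simp only [Finset.mem_filter]
    exact ⟨fun ⟨a, c⟩ => ⟨a, by omega⟩,
      fun ⟨a, c⟩ => ⟨a, by by_contra hx; exact h i (by omega) c a⟩⟩

lemma blockIndex_le_card (J : Finset ℕ) (x : ℕ) : blockIndex J x ≤ J.card :=
  Finset.card_filter_le _ _

lemma sort_insert_of_lt {m : ℕ} {I : Finset ℕ} (h : ∀ i ∈ I, i < m) :
    (insert m I).sort (· ≤ ·) = I.sort (· ≤ ·) ++ [m] := by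
  have hm : m ∉ I := fun hm => lt_irrefl _ (h m hm)
  refine List.Perm.eq_of_pairwise' (r := (· ≤ ·)) (Finset.pairwise_sort _ _) ?_ ?_
  · rw [List.pairwise_append]
    refine ⟨Finset.pairwise_sort _ _, by simp, ?_⟩
    intro a ha b hb
    simp at ha hb
    subst hb
    exact (h a ha).le
  · rw [← Multiset.coe_eq_coe, Finset.sort_eq, Finset.insert_val_of_notMem hm,
      ← Multiset.coe_add, Finset.sort_eq]
    rw [Multiset.coe_singleton, add_comm, Multiset.singleton_add]

lemma compParts_insert_of_lt (N : ℕ) {m : ℕ} {I : Finset ℕ} (h : ∀ i ∈ I, i < m) :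
    compParts N (insert m I) = compParts (m + 1) I + {N - (m + 1)} := by
  unfold compParts
  rw [sort_insert_of_lt h, List.map_append, List.map_singleton, ← List.cons_append,
    List.zipWith_append (by simp), ← Multiset.coe_add]
  simp

lemma prod_factorial_compParts (J : Finset ℕ) : ∀ N : ℕ, J ⊆ Finset.range N →
    ((compParts N J).map Nat.factorial).prod =
      ∏ v ∈ Finset.range (J.card + 1),
        ((Finset.range N).filter (fun x => blockIndex J x = v)).card.factorial := by
  induction J using Finset.induction_on_max with
  | empty => intro N _; simp [compParts, blockIndex]
  | insert m I h ih =>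
    intro N hN
    have hm : m ∉ I := fun hm => lt_irrefl _ (h m hm)
    have hmN : m < N := by simpa using hN (Finset.mem_insert_self m I)
    have hIm : I ⊆ Finset.range (m + 1) := fun i hi => by
      have := h i hi; simp; omega
    have hlow : ∀ x, x ≤ m → blockIndex (insert m I) x = blockIndex I x := by
      intro x hx
      unfold blockIndex
      rw [Finset.filter_insert, if_neg (by omega)]
    have hhigh : ∀ x, m < x → blockIndex (insert m I) x = I.card + 1 := by
      intro x hx
      unfold blockIndex
      rw [Finset.filter_true_of_mem, Finset.card_insert_of_notMem hm]
      intro i hi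
      rcases Finset.mem_insert.1 hi with rfl | hi
      · exact hx
      · exact (h i hi).trans hx
    rw [compParts_insert_of_lt N h, Multiset.map_add, Multiset.prod_add, ih _ hIm,
      Finset.card_insert_of_notMem hm, Finset.prod_range_succ _ (I.card + 1)]
    congr 1
    · refine Finset.prod_congr rfl fun v hv => ?_
      congr 2
      ext x
      simp only [Finset.mem_filter, Finset.mem_range] at hv ⊢
      constructor
      · rintro ⟨hx, rfl⟩
        exact ⟨by omega, hlow x (by omega)⟩
      · rintro ⟨hx, hxv⟩
        have hxm : x ≤ m := by
          by_contra hc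
          rw [hhigh x (by omega)] at hxv
          omega
        exact ⟨by omega, by rw [← hxv, hlow x hxm]⟩
    · simp only [Multiset.map_singleton, Multiset.prod_singleton]
      congr 1
      have : (Finset.range N).filter (fun x => blockIndex (insert m I) x = I.card + 1)
          = Finset.Ico (m + 1) N := by
        ext x
        simp only [Finset.mem_filter, Finset.mem_range, Finset.mem_Ico]
        constructor
        · rintro ⟨hx, hxv⟩
          refine ⟨?_, hx⟩
          by_contra hc
          rw [hlow x (by omega)] at hxv
          have := blockIndex_le_card I x
          omega
        · rintro ⟨h1, h2⟩
          exact ⟨h2, hhigh x h1⟩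
      rw [this, Nat.card_Ico]

lemma card_perm_fixing_blocks {N : ℕ} {J : Finset ℕ} (hJ : J ⊆ Finset.range N) :
    Nat.card {g : Perm (Fin N) // (fun x : Fin N => blockIndex J x) ∘ g =
      fun x : Fin N => blockIndex J x}
      = ((compParts N J).map Nat.factorial).prod := by
  rw [Nat.card_eq_fintype_card, DomMulAct.stabilizer_card', prod_factorial_compParts J N hJ]
  have key : ∀ v, Fintype.card {x : Fin N // blockIndex J x = v} =
      ((Finset.range N).filter (fun x => blockIndex J x = v)).card := by
    intro v
    rw [Fintype.card_subtype, ← Finset.card_map Fin.valEmbedding]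
    congr 1
    ext x
    simp only [Finset.mem_map, Finset.mem_filter, Finset.mem_univ, true_and,
      Fin.valEmbedding_apply, Finset.mem_range]
    constructor
    · rintro ⟨y, hy, rfl⟩
      exact ⟨y.isLt, hy⟩
    · rintro ⟨hx, hxv⟩
      exact ⟨⟨x, hx⟩, hxv, rfl⟩
  simp only [key]
  refine Finset.prod_subset ?_ ?_
  · intro v hv
    simp only [Finset.mem_image, Finset.mem_univ, true_and] at hv
    obtain ⟨x, rfl⟩ := hv
    have := blockIndex_le_card J x
    simp
    omega
  · intro v _ hv
    rw [Finset.card_eq_zero.2, Nat.factorial_zero]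
    refine Finset.filter_eq_empty_iff.2 fun x hx hxv => hv ?_
    simp only [Finset.mem_image, Finset.mem_univ, true_and]
    exact ⟨⟨x, Finset.mem_range.1 hx⟩, hxv⟩

lemma card_perm_zero_eq (n : ℕ) (p : Fin (n + 1)) :
    Nat.card {σ : Perm (Fin (n + 1)) // σ 0 = p} = n.factorial := by
  have e : {σ : Perm (Fin (n + 1)) // σ 0 = p} ≃ Perm (Fin n) :=
    { toFun := fun σ => (Perm.decomposeFin σ.1).2
      invFun := fun τ => ⟨Perm.decomposeFin.symm (p, τ), by simp⟩
      left_inv := by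
        rintro ⟨σ, rfl⟩
        obtain ⟨⟨q, τ⟩, rfl⟩ := Perm.decomposeFin.symm.surjective σ
        simp
      right_inv := fun τ => by simp }
  rw [Nat.card_congr e, Nat.card_eq_fintype_card, Fintype.card_perm, Fintype.card_fin]

section

variable {n : ℕ} {b : Fin (n + 1) → ℕ}

lemma card_words_mul_card_stabilizer (hlast : ∀ x, b x = b (Fin.last n) → x = Fin.last n) :
    Nat.card {w : Fin (n + 1) → ℕ // ∃ σ : Perm (Fin (n + 1)), σ 0 = Fin.last n ∧ b ∘ σ = w} *
      Nat.card {g : Perm (Fin (n + 1)) // b ∘ g = b} = n.factorial := by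
  rw [← card_perm_zero_eq n (Fin.last n), ← Nat.card_prod]
  let s : {w : Fin (n + 1) → ℕ // ∃ σ : Perm (Fin (n + 1)), σ 0 = Fin.last n ∧ b ∘ σ = w} →
      Perm (Fin (n + 1)) := fun w => w.2.choose
  have hs0 : ∀ w, s w 0 = Fin.last n := fun w => w.2.choose_spec.1
  have hs : ∀ w, b ∘ s w = w.1 := fun w => w.2.choose_spec.2
  refine Nat.card_congr
    { toFun := fun p => ⟨p.2.1 * s p.1, ?_⟩
      invFun := fun σ => ⟨⟨b ∘ σ.1, σ.1, σ.2, rfl⟩,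
        ⟨σ.1 * (s ⟨b ∘ σ.1, σ.1, σ.2, rfl⟩)⁻¹, ?_⟩⟩
      left_inv := ?_
      right_inv := ?_ }
  · rw [Perm.mul_apply, hs0]
    exact hlast _ (congrFun p.2.2 _)
  · have h := hs ⟨b ∘ σ.1, σ.1, σ.2, rfl⟩
    funext x
    simpa using (congrFun h ((s ⟨b ∘ σ.1, σ.1, σ.2, rfl⟩)⁻¹ x)).symm
  · rintro ⟨w, g, hg⟩
    have hw : b ∘ (g * s w : Perm _) = w.1 := by
      rw [Perm.coe_mul, ← Function.comp_assoc, hg, hs]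
    have h1 : ∀ h, (⟨b ∘ (g * s w : Perm _), h⟩ :
        {w : Fin (n + 1) → ℕ // ∃ σ : Perm (Fin (n + 1)), σ 0 = Fin.last n ∧ b ∘ σ = w}) = w :=
      fun h => Subtype.ext hw
    ext1
    · exact h1 _
    · apply Subtype.ext
      simp only [h1, mul_inv_cancel_right]
  · rintro ⟨σ, hσ⟩
    simp

lemma IsBlockListing.lt_of_lt (hb : Monotone b) {e e' : Perm (Fin (n + 1))}
    (he : IsBlockListing b e) (he' : IsBlockListing b e') (h : b ∘ e = b ∘ e') :
    ∀ (d : ℕ) (i j : Fin (n + 1)), i + (d : Fin (n + 1)) = 0 → e i < e j → e' i < e' j := by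
  have hw : ∀ i, b (e i) = b (e' i) := congrFun h
  intro d
  induction d with
  | zero =>
    intro i j hi hij
    simp only [Nat.cast_zero, add_zero] at hi
    rw [hi, he.1] at hij
    exact absurd hij (Fin.le_last _).not_gt
  | succ d ih =>
    intro i j hi hij
    rcases (hb hij.le).lt_or_eq with hlt | heq
    · rw [hw, hw] at hlt
      exact hb.reflect_lt hlt
    · have h1 := ih (i + 1) (j + 1) (by rw [← hi]; push_cast; ring) (he.2 i j heq hij)
      rcases lt_trichotomy (e' i) (e' j) with h2 | h2 | h2
      · exact h2
      · rw [e'.injective h2] at hij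
        exact absurd hij (lt_irrefl _)
      · exact absurd (he'.2 j i (by rw [← hw, ← hw, heq]) h2) h1.not_gt

lemma IsBlockListing.eq_of_comp_eq (hb : Monotone b) {e e' : Perm (Fin (n + 1))}
    (he : IsBlockListing b e) (he' : IsBlockListing b e') (h : b ∘ e = b ∘ e') : e = e' := by
  have hlt : ∀ i j, e i < e j → e' i < e' j := fun i j =>
    he.lt_of_lt hb he' h (-i : Fin (n + 1)).val i j (by simp)
  have hmono : StrictMono (e' * e⁻¹ : Perm _) := fun x y hxy => by
    simpa using hlt (e⁻¹ x) (e⁻¹ y) (by simpa using hxy)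
  have : (e' * e⁻¹ : Perm _) = 1 := by
    have h2 := Tuple.unique_monotone (f := id) (σ := e' * e⁻¹) (τ := 1) hmono.monotone monotone_id
    exact DFunLike.coe_injective h2
  exact (mul_inv_eq_one.1 this).symm

lemma exists_isBlockListing (hb : Monotone b)
    (hlast : ∀ x, b x = b (Fin.last n) → x = Fin.last n) (σ : Perm (Fin (n + 1)))
    (hσ : σ 0 = Fin.last n) : ∃ e, IsBlockListing b e ∧ b ∘ e = b ∘ σ := by
  set w : Fin (n + 1) → ℕ := b ∘ σ with hw
  have hw0 : ∀ i, i ≠ 0 → w i < w 0 := by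
    intro i hi
    have h1 : w i ≤ w 0 := by
      simp only [hw, Function.comp_apply, hσ]
      exact hb (Fin.le_last _)
    refine h1.lt_of_ne fun h => hi (σ.injective ?_)
    rw [hσ]
    exact hlast _ (by simpa [hw, hσ] using h)
  let key : Fin (n + 1) → Lex (Fin (n + 1) → ℕ) := fun i => toLex fun t => w (i + t)
  have key_lt : ∀ i j, key i < key j ↔
      ∃ t, (∀ s, s < t → w (i + s) = w (j + s)) ∧ w (i + t) < w (j + t) := fun i j => Iff.rfl
  have key_inj : Function.Injective key := by
    intro i j hij
    have h1 : w (i + -i) = w (j + -i) := congrFun (congrArg ofLex hij) (-i)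
    by_contra hne
    rw [add_neg_cancel] at h1
    exact (hw0 (j + -i) (by rwa [← sub_eq_add_neg, sub_ne_zero, ne_comm])).ne h1.symm
  have key_of_lt : ∀ i j, w i < w j → key i < key j := fun i j h =>
    (key_lt i j).2 ⟨0, fun s hs => absurd hs (Fin.zero_le s).not_gt, by simpa using h⟩
  have key_succ : ∀ i j, w i = w j → key i < key j → key (i + 1) < key (j + 1) := by
    intro i j hij h
    obtain ⟨t, ht, hlt⟩ := (key_lt i j).1 h
    have ht0 : t ≠ 0 := by
      rintro rfl
      simp [hij] at hlt
    have hsub : ∀ a : Fin (n + 1), a + 1 + (t - 1) = a + t := fun a => by ring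
    have ht1 : 0 < t.val := Nat.pos_of_ne_zero fun h => ht0 (Fin.ext h)
    refine (key_lt _ _).2 ⟨t - 1, fun s hs => ?_, by rwa [hsub, hsub]⟩
    have := ht (1 + s) (by
      have h2 := Fin.val_sub_one_of_ne_zero ht0
      rw [Fin.lt_def] at hs ⊢
      rw [Fin.val_add]
      have h3 : ((1 : Fin (n + 1)) : ℕ) ≤ 1 := by rw [Fin.val_one']; exact Nat.mod_le _ _
      have := Nat.mod_le (((1 : Fin (n + 1)) : ℕ) + s) (n + 1)
      omega)
    rwa [← add_assoc, ← add_assoc] at this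
  have hmono : StrictMono (key ∘ Tuple.sort key) :=
    (Tuple.monotone_sort key).strictMono_of_injective
      (key_inj.comp (Tuple.sort key).injective)
  set e : Perm (Fin (n + 1)) := (Tuple.sort key)⁻¹
  have elt : ∀ i j, e i < e j ↔ key i < key j := by
    intro i j
    rw [← hmono.lt_iff_lt]
    have hkey : ∀ k, key (Tuple.sort key (e k)) = key k := fun k =>
      congrArg key ((Tuple.sort key).apply_symm_apply k)
    simp only [Function.comp_apply, hkey]
    exact Iff.rfl
  have hwe : b ∘ e = w := by
    have h1 : Monotone (b ∘ (σ * e⁻¹ : Perm _)) := by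
      intro x y hxy
      by_contra hc
      have h2 := key_of_lt (e⁻¹ y) (e⁻¹ x) (not_le.1 hc)
      rw [← elt] at h2
      simp at h2
      exact absurd hxy h2.not_ge
    have h2 := Tuple.unique_monotone (f := b) (σ := σ * e⁻¹) (τ := 1) h1 hb
    funext i
    simpa [hw] using (congrFun h2 (e i)).symm
  refine ⟨e, ⟨?_, fun i j hij h => ?_⟩, hwe⟩
  · by_contra hne
    have h1 : e 0 < e (e⁻¹ (Fin.last n)) := by
      simpa using lt_of_le_of_ne (Fin.le_last _) hne
    have h2 : e⁻¹ (Fin.last n) ≠ 0 := fun h => hne (by rw [← h]; simp)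
    rw [elt] at h1
    exact absurd (key_of_lt _ _ (hw0 _ h2)) h1.not_gt
  · rw [elt] at h ⊢
    have hwe' := fun k => congrFun hwe k
    simp only [Function.comp_apply] at hwe'
    exact key_succ i j (by rw [← hwe', ← hwe', hij]) h

lemma card_isBlockListing (hb : Monotone b)
    (hlast : ∀ x, b x = b (Fin.last n) → x = Fin.last n) :
    Nat.card {e // IsBlockListing b e} =
      Nat.card {w : Fin (n + 1) → ℕ //
        ∃ σ : Perm (Fin (n + 1)), σ 0 = Fin.last n ∧ b ∘ σ = w} := by
  refine Nat.card_eq_of_bijective (fun e => ⟨b ∘ e.1, e.1, e.2.1, rfl⟩) ⟨?_, ?_⟩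
  · rintro ⟨e, he⟩ ⟨e', he'⟩ h
    exact Subtype.ext (he.eq_of_comp_eq hb he' (congrArg Subtype.val h))
  · rintro ⟨w, σ, hσ, rfl⟩
    obtain ⟨e, he, h⟩ := exists_isBlockListing hb hlast σ hσ
    exact ⟨⟨e, he⟩, Subtype.ext h⟩

end

lemma finRotate_pow_apply (n k : ℕ) (i : Fin (n + 1)) :
    (finRotate (n + 1) ^ k) i = i + (k : Fin (n + 1)) := by
  induction k with
  | zero => simp
  | succ k ih => rw [pow_succ', Perm.mul_apply, ih, finRotate_apply]; push_cast; ring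

lemma isCyclic'_conj_finRotate {n : ℕ} (e : Perm (Fin (n + 1))) :
    IsCyclic' (e * finRotate (n + 1) * e⁻¹) := by
  intro x y
  refine ⟨(e⁻¹ y - e⁻¹ x).val, ?_⟩
  rw [conj_pow]
  simp [Perm.mul_apply, finRotate_pow_apply]

lemma IsCyclic'.exists_eq_conj_finRotate {n : ℕ} {π : Perm (Fin (n + 1))} (hπ : IsCyclic' π)
    (p : Fin (n + 1)) : ∃ e : Perm (Fin (n + 1)), e 0 = p ∧ e * finRotate (n + 1) * e⁻¹ = π := by
  have hord : ∃ e : Perm (Fin (n + 1)), e * finRotate (n + 1) * e⁻¹ = π := by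
    rw [← isConj_iff]
    rcases n with _ | n
    · rw [show finRotate (0 + 1) = π from Equiv.ext fun _ => Subsingleton.elim (α := Fin 1) _ _]
    · have hfix : ∀ x, π x ≠ x := by
        intro x hx
        obtain ⟨y, hy⟩ := exists_ne x
        obtain ⟨k, hk⟩ := hπ x y
        rw [Perm.pow_apply_eq_self_of_apply_eq_self hx] at hk
        exact hy hk.symm
      have hc : π.IsCycle := ⟨0, hfix 0, fun y _ => by
        obtain ⟨k, hk⟩ := hπ 0 y
        exact ⟨k, by simpa using hk⟩⟩
      refine isCycle_finRotate.isConj hc ?_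
      rw [support_finRotate]
      congr 1
      ext x
      simp [hfix x]
  obtain ⟨e, rfl⟩ := hord
  obtain ⟨k, hk⟩ : ∃ k : ℕ, (finRotate (n + 1) ^ k) 0 = e⁻¹ p :=
    ⟨(e⁻¹ p).val, by rw [finRotate_pow_apply]; simp⟩
  refine ⟨e * finRotate (n + 1) ^ k, by simp [hk], ?_⟩
  group

lemma eq_of_conj_finRotate_eq {n : ℕ} {e e' : Perm (Fin (n + 1))} (h0 : e 0 = e' 0)
    (h : e * finRotate (n + 1) * e⁻¹ = e' * finRotate (n + 1) * e'⁻¹) : e = e' := by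
  ext1 i
  obtain ⟨k, rfl⟩ : ∃ k : ℕ, (finRotate (n + 1) ^ k) 0 = i :=
    ⟨i.val, by rw [finRotate_pow_apply]; simp⟩
  have h1 : ((e * finRotate (n + 1) * e⁻¹) ^ k) (e 0) =
      ((e' * finRotate (n + 1) * e'⁻¹) ^ k) (e' 0) := by rw [h, h0]
  rw [conj_pow, conj_pow] at h1
  simpa using h1

lemma descSet_subset_iff {N : ℕ} (π : Perm (Fin N)) (J : Finset ℕ) :
    descSet π ⊆ J ↔ ∀ x y : Fin N, blockIndex J x = blockIndex J y → x < y → π x < π y := by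
  constructor
  · intro h x y hxy hlt
    rw [blockIndex_eq_iff J hlt.le] at hxy
    have step : ∀ i (hi : i + 1 < N), x ≤ i → i < y → π ⟨i, by omega⟩ < π ⟨i + 1, hi⟩ := by
      intro i hi hxi hiy
      by_contra hc
      refine hxy i hxi hiy (h ?_)
      simp only [descSet, descSeq, Finset.mem_filter, Finset.mem_range]
      refine ⟨by omega, hi, ?_⟩
      rw [← Fin.lt_def]
      refine lt_of_le_of_ne (not_lt.1 hc) fun heq => ?_
      have := π.injective heq
      simp at this
    have main : ∀ d (hd : x.val + d + 1 ≤ y.val), π x < π ⟨x.val + d + 1, by omega⟩ := by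
      intro d
      induction d with
      | zero => intro hd; exact step x (by omega) le_rfl (by omega)
      | succ d ih =>
        intro hd
        exact (ih (by omega)).trans (step (x.val + d + 1) (by omega) (by omega) (by omega))
    have := main (y.val - x.val - 1) (by omega)
    convert this using 3
    omega
  · intro h i hi
    simp only [descSet, descSeq, Finset.mem_filter, Finset.mem_range] at hi
    obtain ⟨_, hi, hlt⟩ := hi
    by_contra hJ
    have := h ⟨i, by omega⟩ ⟨i + 1, hi⟩ ((blockIndex_eq_iff J (by simp)).2 fun k h1 h2 => by
      simp only at h1 h2
      rwa [show k = i by omega]) (by simp [Fin.lt_def])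
    exact absurd hlt (Fin.lt_def.1 this).not_gt

lemma card_isCyclic'_descSet_subset (n : ℕ) (J : Finset ℕ) :
    Nat.card {π : Perm (Fin (n + 1)) // IsCyclic' π ∧ descSet π ⊆ J} =
      Nat.card {e : Perm (Fin (n + 1)) // IsBlockListing (fun x => blockIndex J x) e} := by
  have hiff : ∀ e : Perm (Fin (n + 1)), descSet (e * finRotate (n + 1) * e⁻¹) ⊆ J ↔
      ∀ i j, blockIndex J (e i) = blockIndex J (e j) → e i < e j → e (i + 1) < e (j + 1) := by
    intro e
    rw [descSet_subset_iff, e.surjective.forall₂]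
    simp
  symm
  refine Nat.card_eq_of_bijective
    (fun e => ⟨e.1 * finRotate (n + 1) * e.1⁻¹, isCyclic'_conj_finRotate _,
      (hiff e.1).2 e.2.2⟩) ⟨?_, ?_⟩
  · rintro ⟨e, he⟩ ⟨e', he'⟩ h
    exact Subtype.ext
      (eq_of_conj_finRotate_eq (he.1.trans he'.1.symm) (congrArg Subtype.val h))
  · rintro ⟨π, hπ, hJ⟩
    obtain ⟨e, he, rfl⟩ := hπ.exists_eq_conj_finRotate (Fin.last n)
    exact ⟨⟨e, he, (hiff e).1 hJ⟩, rfl⟩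

end CyclicDescents

theorem stmt12 (n : ℕ) (hn : 1 ≤ n) (I : Finset ℕ) (hI : I ⊆ Finset.range (n - 1)) :
    Nat.card {π : Equiv.Perm (Fin (n + 1)) //
        IsCyclic' π ∧ descSet π ⊆ I ∪ {n - 1}}
      = Nat.factorial n / ((compParts n I).map Nat.factorial).prod := by
  obtain ⟨m, rfl⟩ : ∃ m, n = m + 1 := ⟨n - 1, by omega⟩
  simp only [Nat.add_sub_cancel] at hI ⊢
  have hlt : ∀ i ∈ I, i < m := fun i hi => Finset.mem_range.1 (hI hi)
  rw [Finset.union_comm, Finset.singleton_union]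
  set J := insert m I with hJ
  have hparts : ((compParts (m + 1 + 1) J).map Nat.factorial).prod =
      ((compParts (m + 1) I).map Nat.factorial).prod := by
    rw [hJ, compParts_insert_of_lt _ hlt]
    simp
  have hJsub : J ⊆ Finset.range (m + 1 + 1) := by
    intro i hi
    rcases Finset.mem_insert.1 hi with rfl | hi
    · simp
    · have := hlt i hi
      simp
      omega
  have hb : Monotone fun x : Fin (m + 1 + 1) => blockIndex J x := fun _ _ h =>
    blockIndex_mono J h
  have hlast : ∀ x : Fin (m + 1 + 1), blockIndex J x = blockIndex J (Fin.last (m + 1)) →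
      x = Fin.last (m + 1) := by
    intro x hx
    rw [blockIndex_eq_iff J (Fin.le_last x)] at hx
    by_contra hne
    have := Fin.val_lt_last hne
    exact hx m (by omega) (by simp) (Finset.mem_insert_self m I)
  have hmul := card_words_mul_card_stabilizer (b := fun x => blockIndex J x) hlast
  rw [card_perm_fixing_blocks hJsub, hparts, ← card_isBlockListing hb hlast,
    ← card_isCyclic'_descSet_subset] at hmul
  refine Nat.eq_div_of_mul_eq_left ?_ hmul
  intro h0
  rw [h0, mul_zero] at hmul
  exact (Nat.factorial_pos _).ne hmul
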